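/- Let f be a bounded solution of the capillary problem on the sector Ω that is discontinuous at O, and assume the radial limit Rf(θ) exists for every θ ∈ (−α, α). Suppose f has a decreasing upper fan: there exist α₂ ∈ (−α, α] and η > 0 such that Rf is constant on [α₂, α) and strictly decreasing on [α₂ − η, α₂] ∩ (−α, α); set β⁺ = α − α₂. Then for every λ ∈ (β⁺, π), 1 + A⁺_S(sin(λ − β⁺)/sin λ) ≤ sin(β⁺)/sin λ. -/

import Mathlib

open Real Set Filter MeasureTheory Topology

noncomputable section

/-- The open circular sector with vertex `O = (0,0)`, half-opening angle `α`, radius `δ`. -/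
def sector (α δ : ℝ) : Set (ℝ × ℝ) :=
  {p | ∃ r θ : ℝ, 0 < r ∧ r < δ ∧ -α < θ ∧ θ < α ∧ p = (r * Real.cos θ, r * Real.sin θ)}

/-- The gradient of `f : ℝ × ℝ → ℝ`. -/
def grad (f : ℝ × ℝ → ℝ) (p : ℝ × ℝ) : ℝ × ℝ :=
  (fderiv ℝ f p (1, 0), fderiv ℝ f p (0, 1))

/-- `Tf = ∇f / √(1 + |∇f|²)`. -/
def Tf (f : ℝ × ℝ → ℝ) (p : ℝ × ℝ) : ℝ × ℝ :=
  ((grad f p).1 / Real.sqrt (1 + (grad f p).1 ^ 2 + (grad f p).2 ^ 2),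
   (grad f p).2 / Real.sqrt (1 + (grad f p).1 ^ 2 + (grad f p).2 ^ 2))

/-- `Nf = div (Tf)`. -/
def Nf (f : ℝ × ℝ → ℝ) (p : ℝ × ℝ) : ℝ :=
  fderiv ℝ (fun q => (Tf f q).1) p (1, 0) + fderiv ℝ (fun q => (Tf f q).2) p (0, 1)

/-- Euclidean dot product on `ℝ × ℝ`. -/
def dot (v w : ℝ × ℝ) : ℝ := v.1 * w.1 + v.2 * w.2

/-- `f` is a bounded solution of the capillary problem `Nf = κ f + lam₀` in the sector,
`Tf ⬝ ν = cos γ` on the two open edges, with contact angles `γp, γm : (0,δ) → [0,π]`. -/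
structure IsCapillarySolution (α δ κ lam₀ : ℝ) (γp γm : ℝ → ℝ) (f : ℝ × ℝ → ℝ) : Prop where
  measurable_γp : Measurable γp
  measurable_γm : Measurable γm
  range_γp : ∀ s ∈ Ioo (0:ℝ) δ, γp s ∈ Icc 0 π
  range_γm : ∀ s ∈ Ioo (0:ℝ) δ, γm s ∈ Icc 0 π
  bounded : ∃ M : ℝ, ∀ p ∈ sector α δ, |f p| ≤ M
  smooth : ContDiffOn ℝ 2 f (sector α δ)
  pde : ∀ p ∈ sector α δ, Nf f p = κ * f p + lam₀
  edgeP_smooth : ∀ s ∈ Ioo (0:ℝ) δ, ContDiffAt ℝ 1 f (s * Real.cos α, s * Real.sin α)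
  edgeM_smooth : ∀ s ∈ Ioo (0:ℝ) δ, ContDiffAt ℝ 1 f (s * Real.cos α, -(s * Real.sin α))
  bcP : ∀ s ∈ Ioo (0:ℝ) δ,
    dot (Tf f (s * Real.cos α, s * Real.sin α)) (-Real.sin α, Real.cos α) = Real.cos (γp s)
  bcM : ∀ s ∈ Ioo (0:ℝ) δ,
    dot (Tf f (s * Real.cos α, -(s * Real.sin α))) (-Real.sin α, -Real.cos α) = Real.cos (γm s)

/-- `L` is the radial limit `Rf(θ)` of `f` in direction `θ`. -/
def RadialLimitAt (f : ℝ × ℝ → ℝ) (θ L : ℝ) : Prop :=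
  Tendsto (fun r => f (r * Real.cos θ, r * Real.sin θ)) (𝓝[>] (0:ℝ)) (𝓝 L)

/-- `f` is discontinuous at the corner `O`: `f(x)` has no limit as `Ω ∋ x → O`. -/
def DiscontinuousAtCorner (α δ : ℝ) (f : ℝ × ℝ → ℝ) : Prop :=
  ¬ ∃ L : ℝ, Tendsto f (𝓝[sector α δ] ((0:ℝ), (0:ℝ))) (𝓝 L)

/-- `A_I(b) = liminf_{ε→0⁺} (1/ε) ∫₀^{bε} cos γ(t) dt`. -/
def fanAI (γ : ℝ → ℝ) (b : ℝ) : ℝ :=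
  liminf (fun ε : ℝ => ε⁻¹ * ∫ t in Ioo (0:ℝ) (b * ε), Real.cos (γ t)) (𝓝[>] (0:ℝ))

/-- `A_S(b) = limsup_{ε→0⁺} (1/ε) ∫₀^{bε} cos γ(t) dt`. -/
def fanAS (γ : ℝ → ℝ) (b : ℝ) : ℝ :=
  limsup (fun ε : ℝ => ε⁻¹ * ∫ t in Ioo (0:ℝ) (b * ε), Real.cos (γ t)) (𝓝[>] (0:ℝ))

def wmap (p1 p2 d1 d2 : ℝ) (x : ℝ × ℝ) : ℝ × ℝ :=
  (x.1 * (p1 + x.2 * d1), x.1 * (p2 + x.2 * d2))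

lemma wmap_cont (p1 p2 d1 d2 : ℝ) : Continuous (wmap p1 p2 d1 d2) := by
  unfold wmap; fun_prop

lemma wmap_deriv (p1 p2 d1 d2 : ℝ) (x : ℝ × ℝ) : ∃ L : ℝ × ℝ →L[ℝ] ℝ × ℝ,
    HasFDerivAt (wmap p1 p2 d1 d2) L x ∧ L (1, 0) = (p1 + x.2 * d1, p2 + x.2 * d2) ∧
      L (0, 1) = (x.1 * d1, x.1 * d2) := by
  have h1 : HasFDerivAt (fun x : ℝ × ℝ => x.1) (ContinuousLinearMap.fst ℝ ℝ ℝ) x := hasFDerivAt_fst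
  have h2 : HasFDerivAt (fun x : ℝ × ℝ => x.2) (ContinuousLinearMap.snd ℝ ℝ ℝ) x := hasFDerivAt_snd
  refine ⟨_, (h1.mul ((h2.mul_const d1).const_add p1)).prodMk
    (h1.mul ((h2.mul_const d2).const_add p2)), ?_, ?_⟩
  · simp
  · simp

lemma wedge_div (p1 p2 d1 d2 ρ ε K : ℝ) (hρε : ρ ≤ ε) (V1 V2 U H : ℝ × ℝ → ℝ)
    (c1 : ∀ x ∈ Icc (ρ, (0:ℝ)) (ε, (1:ℝ)), ContinuousAt V1 (wmap p1 p2 d1 d2 x))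
    (c2 : ∀ x ∈ Icc (ρ, (0:ℝ)) (ε, (1:ℝ)), ContinuousAt V2 (wmap p1 p2 d1 d2 x))
    (c3 : ∀ x ∈ Icc (ρ, (0:ℝ)) (ε, (1:ℝ)), ContinuousAt U (wmap p1 p2 d1 d2 x))
    (hH : ContinuousOn H (Icc (ρ, (0:ℝ)) (ε, (1:ℝ))))
    (hK : ∀ x ∈ Ioo ρ ε ×ˢ Ioo (0:ℝ) 1, -K ≤ H x)
    (hd : ∀ x ∈ Ioo ρ ε ×ˢ Ioo (0:ℝ) 1, ∃ A1 A2 A3 : ℝ × ℝ →L[ℝ] ℝ,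
      HasFDerivAt V1 A1 (wmap p1 p2 d1 d2 x) ∧ HasFDerivAt V2 A2 (wmap p1 p2 d1 d2 x) ∧
      HasFDerivAt U A3 (wmap p1 p2 d1 d2 x) ∧
      x.1 * (p1 * d2 - p2 * d1) * (A1 (1, 0) + A2 (0, 1)) + x.1 * (d1 * A3 (1, 0) + d2 * A3 (0, 1)) = H x) :
    -K * (ε - ρ) ≤
      (((∫ s in ρ..ε, (U (wmap p1 p2 d1 d2 (s, 1)) + (V2 (wmap p1 p2 d1 d2 (s, 1)) * (p1 + 1 * d1)
          - V1 (wmap p1 p2 d1 d2 (s, 1)) * (p2 + 1 * d2)))) -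
        ∫ s in ρ..ε, (U (wmap p1 p2 d1 d2 (s, 0)) + (V2 (wmap p1 p2 d1 d2 (s, 0)) * (p1 + 0 * d1)
          - V1 (wmap p1 p2 d1 d2 (s, 0)) * (p2 + 0 * d2)))) +
        ∫ t in (0:ℝ)..1, ε * (V1 (wmap p1 p2 d1 d2 (ε, t)) * d2 - V2 (wmap p1 p2 d1 d2 (ε, t)) * d1)) -
        ∫ t in (0:ℝ)..1, ρ * (V1 (wmap p1 p2 d1 d2 (ρ, t)) * d2 - V2 (wmap p1 p2 d1 d2 (ρ, t)) * d1) := by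
  set Φ := wmap p1 p2 d1 d2 with hΦ
  have hΦc : Continuous Φ := wmap_cont _ _ _ _
  set P : ℝ × ℝ → ℝ := fun x => x.1 * (V1 (Φ x) * d2 - V2 (Φ x) * d1) with hP
  set G : ℝ × ℝ → ℝ := fun x => U (Φ x) + (V2 (Φ x) * (p1 + x.2 * d1) - V1 (Φ x) * (p2 + x.2 * d2))
    with hG
  have k1 : ContinuousOn (fun x => V1 (Φ x)) (Icc (ρ, (0:ℝ)) (ε, (1:ℝ))) := fun x hx =>
    (ContinuousAt.comp (f := Φ) (c1 x hx) hΦc.continuousAt).continuousWithinAt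
  have k2 : ContinuousOn (fun x => V2 (Φ x)) (Icc (ρ, (0:ℝ)) (ε, (1:ℝ))) := fun x hx =>
    (ContinuousAt.comp (f := Φ) (c2 x hx) hΦc.continuousAt).continuousWithinAt
  have k3 : ContinuousOn (fun x => U (Φ x)) (Icc (ρ, (0:ℝ)) (ε, (1:ℝ))) := fun x hx =>
    (ContinuousAt.comp (f := Φ) (c3 x hx) hΦc.continuousAt).continuousWithinAt
  have hder : ∀ x ∈ Ioo ρ ε ×ˢ Ioo (0:ℝ) 1, ∃ P' G' : ℝ × ℝ →L[ℝ] ℝ, HasFDerivAt P P' x ∧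
      HasFDerivAt G G' x ∧ P' (1, 0) + G' (0, 1) = H x := by
    intro x hx
    obtain ⟨A1, A2, A3, h1, h2, h3, hh⟩ := hd x hx
    obtain ⟨L, hL, hL1, hL2⟩ := wmap_deriv p1 p2 d1 d2 x
    have g1 := h1.comp x hL
    have g2 := h2.comp x hL
    have g3 := h3.comp x hL
    have e1 : HasFDerivAt (fun x : ℝ × ℝ => x.1) (ContinuousLinearMap.fst ℝ ℝ ℝ) x := hasFDerivAt_fst
    have e2 : HasFDerivAt (fun x : ℝ × ℝ => x.2) (ContinuousLinearMap.snd ℝ ℝ ℝ) x := hasFDerivAt_snd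
    refine ⟨_, _, e1.mul ((g1.mul_const d2).sub (g2.mul_const d1)),
      g3.add ((g2.mul ((e2.mul_const d1).const_add p1)).sub
        (g1.mul ((e2.mul_const d2).const_add p2))), ?_⟩
    rw [← hh]
    have lin : ∀ (A : ℝ × ℝ →L[ℝ] ℝ) (a b : ℝ), A (a, b) = a * A (1, 0) + b * A (0, 1) := by
      intro A a b
      have : ((a, b) : ℝ × ℝ) = a • ((1:ℝ), (0:ℝ)) + b • ((0:ℝ), (1:ℝ)) := by simp
      rw [this, map_add, map_smul, map_smul, smul_eq_mul, smul_eq_mul]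
    simp [hL1, hL2]
    simp only [lin A1 (p1 + x.2 * d1) _, lin A2 (p1 + x.2 * d1) _, lin A1 (x.1 * d1) _,
      lin A2 (x.1 * d1) _, lin A3 (x.1 * d1) _]
    ring
  have hae : (Ioo ρ ε ×ˢ Ioo (0:ℝ) 1 : Set (ℝ × ℝ)) =ᵐ[volume] Icc (ρ, (0:ℝ)) (ε, (1:ℝ)) := by
    rw [← Icc_prod_Icc]
    exact Measure.set_prod_ae_eq Ioo_ae_eq_Icc Ioo_ae_eq_Icc
  have heq : ∀ x ∈ Ioo ρ ε ×ˢ Ioo (0:ℝ) 1, fderiv ℝ P x (1, 0) + fderiv ℝ G x (0, 1) = H x := by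
    intro x hx
    obtain ⟨P', G', h1, h2, h3⟩ := hder x hx
    rw [h1.fderiv, h2.fderiv, h3]
  have hmeas : MeasurableSet (Ioo ρ ε ×ˢ Ioo (0:ℝ) 1 : Set (ℝ × ℝ)) :=
    measurableSet_Ioo.prod measurableSet_Ioo
  have hint : IntegrableOn H (Icc (ρ, (0:ℝ)) (ε, (1:ℝ))) := hH.integrableOn_compact isCompact_Icc
  have hint' : IntegrableOn (fun x => fderiv ℝ P x (1, 0) + fderiv ℝ G x (0, 1))
      (Icc (ρ, (0:ℝ)) (ε, (1:ℝ))) := by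
    rw [← integrableOn_congr_set_ae hae]
    rw [← integrableOn_congr_set_ae hae] at hint
    exact hint.congr_fun (fun x hx => (heq x hx).symm) hmeas
  have key := integral_divergence_prod_Icc_of_hasFDerivAt_of_le P G (fderiv ℝ P) (fderiv ℝ G)
    (ρ, 0) (ε, 1) ⟨hρε, zero_le_one⟩
    (continuousOn_fst.mul ((k1.mul continuousOn_const).sub (k2.mul continuousOn_const)))
    (k3.add ((k2.mul (continuousOn_const.add (continuousOn_snd.mul continuousOn_const))).sub
      (k1.mul (continuousOn_const.add (continuousOn_snd.mul continuousOn_const)))))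
    (fun x hx => by
      obtain ⟨P', G', h1, h2, h3⟩ := hder x hx
      exact h1.differentiableAt.hasFDerivAt)
    (fun x hx => by
      obtain ⟨P', G', h1, h2, h3⟩ := hder x hx
      exact h2.differentiableAt.hasFDerivAt) hint'
  have hval : ∫ x in Icc (ρ, (0:ℝ)) (ε, (1:ℝ)), (fderiv ℝ P x (1, 0) + fderiv ℝ G x (0, 1)) =
      ∫ x in Icc (ρ, (0:ℝ)) (ε, (1:ℝ)), H x := by
    rw [← setIntegral_congr_set hae, ← setIntegral_congr_set hae]
    exact setIntegral_congr_fun hmeas heq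
  have hlow : -K * (ε - ρ) ≤ ∫ x in Icc (ρ, (0:ℝ)) (ε, (1:ℝ)), H x := by
    have hv : volume.real (Icc (ρ, (0:ℝ)) (ε, (1:ℝ))) = ε - ρ := by
      rw [← Icc_prod_Icc, Measure.volume_eq_prod, measureReal_prod_prod]
      simp [hρε]
    have hfin : volume (Ioo ρ ε ×ˢ Ioo (0:ℝ) 1 : Set (ℝ × ℝ)) ≠ ⊤ := by
      rw [measure_congr hae]
      exact isCompact_Icc.measure_lt_top.ne
    have hint2 := hint
    rw [← integrableOn_congr_set_ae hae] at hint2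
    have := setIntegral_mono_on (μ := volume) (f := fun _ : ℝ × ℝ => -K) (g := H)
      (integrableOn_const hfin) hint2 hmeas hK
    rw [setIntegral_congr_set hae, setIntegral_congr_set hae] at this
    rw [setIntegral_const, hv, smul_eq_mul] at this
    linarith
  rw [← hval, key] at hlow
  exact hlow

lemma grad_cont {f : ℝ × ℝ → ℝ} {z : ℝ × ℝ} (h : ContDiffAt ℝ 1 f z) :
    ContinuousAt (fun q => (grad f q).1) z ∧ ContinuousAt (fun q => (grad f q).2) z := by
  have := h.continuousAt_fderiv one_ne_zero
  exact ⟨this.clm_apply continuousAt_const, this.clm_apply continuousAt_const⟩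

lemma W_pos (a b : ℝ) : 0 < Real.sqrt (1 + a ^ 2 + b ^ 2) := Real.sqrt_pos.2 (by positivity)

lemma Tf_cont {f : ℝ × ℝ → ℝ} {z : ℝ × ℝ} (h : ContDiffAt ℝ 1 f z) :
    ContinuousAt (fun q => (Tf f q).1) z ∧ ContinuousAt (fun q => (Tf f q).2) z := by
  obtain ⟨h1, h2⟩ := grad_cont h
  have hW : ContinuousAt (fun q => Real.sqrt (1 + (grad f q).1 ^ 2 + (grad f q).2 ^ 2)) z :=
    ((continuousAt_const.add (h1.pow 2)).add (h2.pow 2)).sqrt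
  exact ⟨h1.div hW (W_pos _ _).ne', h2.div hW (W_pos _ _).ne'⟩

lemma Tf_diff {f : ℝ × ℝ → ℝ} {z : ℝ × ℝ} (h : ContDiffAt ℝ 2 f z) :
    DifferentiableAt ℝ (fun q => (Tf f q).1) z ∧ DifferentiableAt ℝ (fun q => (Tf f q).2) z := by
  have h0 : DifferentiableAt ℝ (fderiv ℝ f) z :=
    (h.fderiv_right (m := 1) (by norm_num)).differentiableAt one_ne_zero
  have h1 : DifferentiableAt ℝ (fun q => (grad f q).1) z := h0.clm_apply (differentiableAt_const _)
  have h2 : DifferentiableAt ℝ (fun q => (grad f q).2) z := h0.clm_apply (differentiableAt_const _)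
  have hW : DifferentiableAt ℝ (fun q => Real.sqrt (1 + (grad f q).1 ^ 2 + (grad f q).2 ^ 2)) z :=
    (((differentiableAt_const _).add (h1.pow 2)).add (h2.pow 2)).sqrt (by
      change 1 + (grad f z).1 ^ 2 + (grad f z).2 ^ 2 ≠ 0
      positivity)
  have hne : Real.sqrt (1 + (grad f z).1 ^ 2 + (grad f z).2 ^ 2) ≠ 0 := (W_pos _ _).ne'
  have a0 : DifferentiableAt ℝ (fun q => (Real.sqrt (1 + (grad f q).1 ^ 2 + (grad f q).2 ^ 2))⁻¹) z :=
    hW.fun_inv hne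
  have a1 : DifferentiableAt ℝ (fun q => (Tf f q).1) z := by
    simp only [Tf, div_eq_mul_inv]
    exact h1.fun_mul a0
  have a2 : DifferentiableAt ℝ (fun q => (Tf f q).2) z := by
    simp only [Tf, div_eq_mul_inv]
    exact h2.fun_mul a0
  exact ⟨a1, a2⟩

lemma Tf_norm (f : ℝ × ℝ → ℝ) (z : ℝ × ℝ) : (Tf f z).1 ^ 2 + (Tf f z).2 ^ 2 ≤ 1 := by
  simp only [Tf]
  have hW := W_pos (grad f z).1 (grad f z).2
  rw [div_pow, div_pow, ← add_div, Real.sq_sqrt (by positivity), div_le_one (by positivity)]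
  linarith

lemma cross_le (u1 u2 d1 d2 : ℝ) (h : u1 ^ 2 + u2 ^ 2 ≤ 1) :
    |u1 * d2 - u2 * d1| ≤ Real.sqrt (d1 ^ 2 + d2 ^ 2) := by
  apply Real.abs_le_sqrt
  nlinarith [sq_nonneg (u1 * d1 + u2 * d2), sq_nonneg d1, sq_nonneg d2]

lemma cap_wedge (f : ℝ × ℝ → ℝ) (κ lam₀ a c k p1 p2 d1 d2 ρ ε K : ℝ) (hρε : ρ ≤ ε)
    (hc : ∀ x ∈ Icc (ρ, (0:ℝ)) (ε, (1:ℝ)), ContDiffAt ℝ 1 f (wmap p1 p2 d1 d2 x))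
    (hi : ∀ x ∈ Ioo ρ ε ×ˢ Ioo (0:ℝ) 1, ContDiffAt ℝ 2 f (wmap p1 p2 d1 d2 x) ∧
      Nf f (wmap p1 p2 d1 d2 x) = κ * f (wmap p1 p2 d1 d2 x) + lam₀)
    (hK : ∀ x ∈ Ioo ρ ε ×ˢ Ioo (0:ℝ) 1, ∀ z, z = wmap p1 p2 d1 d2 x →
      -K ≤ x.1 * (p1 * d2 - p2 * d1) * (a * ((grad f z).1 * (Tf f z).1 + (grad f z).2 * (Tf f z).2)
        + (a * f z + c) * (κ * f z + lam₀)) + x.1 * (k * (d1 * (grad f z).1 + d2 * (grad f z).2))) :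
    -K * (ε - ρ) ≤
      (((∫ s in ρ..ε, (k * f (wmap p1 p2 d1 d2 (s, 1)) +
          ((a * f (wmap p1 p2 d1 d2 (s, 1)) + c) * (Tf f (wmap p1 p2 d1 d2 (s, 1))).2 * (p1 + 1 * d1)
          - (a * f (wmap p1 p2 d1 d2 (s, 1)) + c) * (Tf f (wmap p1 p2 d1 d2 (s, 1))).1 * (p2 + 1 * d2)))) -
        ∫ s in ρ..ε, (k * f (wmap p1 p2 d1 d2 (s, 0)) +
          ((a * f (wmap p1 p2 d1 d2 (s, 0)) + c) * (Tf f (wmap p1 p2 d1 d2 (s, 0))).2 * (p1 + 0 * d1)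
          - (a * f (wmap p1 p2 d1 d2 (s, 0)) + c) * (Tf f (wmap p1 p2 d1 d2 (s, 0))).1 * (p2 + 0 * d2)))) +
        ∫ t in (0:ℝ)..1, ε * ((a * f (wmap p1 p2 d1 d2 (ε, t)) + c) * (Tf f (wmap p1 p2 d1 d2 (ε, t))).1 * d2
          - (a * f (wmap p1 p2 d1 d2 (ε, t)) + c) * (Tf f (wmap p1 p2 d1 d2 (ε, t))).2 * d1)) -
        ∫ t in (0:ℝ)..1, ρ * ((a * f (wmap p1 p2 d1 d2 (ρ, t)) + c) * (Tf f (wmap p1 p2 d1 d2 (ρ, t))).1 * d2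
          - (a * f (wmap p1 p2 d1 d2 (ρ, t)) + c) * (Tf f (wmap p1 p2 d1 d2 (ρ, t))).2 * d1) := by
  have hfc : ∀ x ∈ Icc (ρ, (0:ℝ)) (ε, (1:ℝ)), ContinuousAt (fun z => a * f z + c) (wmap p1 p2 d1 d2 x) :=
    fun x hx => (continuousAt_const.mul (hc x hx).continuousAt).add continuousAt_const
  refine wedge_div p1 p2 d1 d2 ρ ε K hρε (fun z => (a * f z + c) * (Tf f z).1)
    (fun z => (a * f z + c) * (Tf f z).2) (fun z => k * f z)
    (fun x => (fun y : ℝ × (ℝ × ℝ) => y.1 * (p1 * d2 - p2 * d1) *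
        (a * ((grad f y.2).1 * (Tf f y.2).1 + (grad f y.2).2 * (Tf f y.2).2)
        + (a * f y.2 + c) * (κ * f y.2 + lam₀)) + y.1 * (k * (d1 * (grad f y.2).1 + d2 * (grad f y.2).2)))
        (x.1, wmap p1 p2 d1 d2 x))
    ?_ ?_ ?_ ?_ ?_ ?_
  · exact fun x hx => (hfc x hx).mul (Tf_cont (hc x hx)).1
  · exact fun x hx => (hfc x hx).mul (Tf_cont (hc x hx)).2
  · exact fun x hx => continuousAt_const.mul (hc x hx).continuousAt
  · intro x hx
    have hΦ : ContinuousAt (wmap p1 p2 d1 d2) x := (wmap_cont _ _ _ _).continuousAt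
    have g1 := ContinuousAt.comp (f := wmap p1 p2 d1 d2) (grad_cont (hc x hx)).1 hΦ
    have g2 := ContinuousAt.comp (f := wmap p1 p2 d1 d2) (grad_cont (hc x hx)).2 hΦ
    have t1 := ContinuousAt.comp (f := wmap p1 p2 d1 d2) (Tf_cont (hc x hx)).1 hΦ
    have t2 := ContinuousAt.comp (f := wmap p1 p2 d1 d2) (Tf_cont (hc x hx)).2 hΦ
    have f1 := ContinuousAt.comp (f := wmap p1 p2 d1 d2) (hc x hx).continuousAt hΦ
    apply ContinuousAt.continuousWithinAt
    have e1 : ContinuousAt (fun x : ℝ × ℝ => x.1) x := continuousAt_fst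
    exact ((e1.mul continuousAt_const).mul
      ((continuousAt_const.mul ((g1.mul t1).add (g2.mul t2))).add
        (((continuousAt_const.mul f1).add continuousAt_const).mul
          ((continuousAt_const.mul f1).add continuousAt_const)))).add
      (e1.mul (continuousAt_const.mul ((continuousAt_const.mul g1).add (continuousAt_const.mul g2))))
  · exact fun x hx => hK x hx _ rfl
  · intro x hx
    obtain ⟨h2, hN⟩ := hi x hx
    have hf := (h2.differentiableAt two_ne_zero).hasFDerivAt
    have hT1 := (Tf_diff h2).1.hasFDerivAt
    have hT2 := (Tf_diff h2).2.hasFDerivAt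
    have hg := (hf.const_mul a).add_const c
    refine ⟨_, _, _, hg.mul hT1, hg.mul hT2, hf.const_mul k, ?_⟩
    simp only [Nf] at hN
    beta_reduce
    dsimp only
    rw [← hN]
    simp [grad]
    ring

lemma sector_open (α δ : ℝ) (hα : α ∈ Ioo 0 π) : IsOpen (sector α δ) := by
  have h : sector α δ = polarCoord.symm '' (Ioo 0 δ ×ˢ Ioo (-α) α) := by
    ext z
    constructor
    · rintro ⟨r, θ, h1, h2, h3, h4, rfl⟩
      exact ⟨(r, θ), ⟨⟨h1, h2⟩, ⟨h3, h4⟩⟩, rfl⟩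
    · rintro ⟨⟨r, θ⟩, ⟨⟨h1, h2⟩, ⟨h3, h4⟩⟩, rfl⟩
      exact ⟨r, θ, h1, h2, h3, h4, rfl⟩
  rw [h]
  apply polarCoord.isOpen_image_symm_of_subset_target (isOpen_Ioo.prod isOpen_Ioo)
  rintro ⟨r, θ⟩ ⟨⟨h1, h2⟩, ⟨h3, h4⟩⟩
  exact ⟨h1, ⟨by linarith [hα.2], by linarith [hα.2]⟩⟩

lemma cone_aux (u a b : ℝ) (hu : 0 < u) (hu' : u < π) (ha : 0 < a) (hb : 0 < b) :
    ∃ r θ : ℝ, 0 < r ∧ 0 < θ ∧ θ < u ∧ a + b * cos u = r * cos θ ∧ b * sin u = r * sin θ := by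
  have hs := sin_pos_of_pos_of_lt_pi hu hu'
  set z : ℂ := ⟨a + b * cos u, b * sin u⟩ with hz
  have him : 0 < z.im := by simp only [hz]; positivity
  have hz0 : z ≠ 0 := by intro h; rw [h] at him; simp at him
  have hr : 0 < ‖z‖ := norm_pos_iff.2 hz0
  have h1 : ‖z‖ * cos z.arg = a + b * cos u := Complex.norm_mul_cos_arg z
  have h2 : ‖z‖ * sin z.arg = b * sin u := Complex.norm_mul_sin_arg z
  have hsθ : 0 < sin z.arg := by
    have : 0 < ‖z‖ * sin z.arg := by rw [h2]; positivity
    exact (mul_pos_iff_of_pos_left hr).1 this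
  have hθ0 : 0 < z.arg := by
    by_contra h
    push Not at h
    have := sin_nonpos_of_nonpos_of_neg_pi_le h (Complex.neg_pi_lt_arg z).le
    linarith
  refine ⟨‖z‖, z.arg, hr, hθ0, ?_, h1.symm, h2.symm⟩
  by_contra h
  push Not at h
  have h3 : 0 ≤ sin (z.arg - u) :=
    sin_nonneg_of_nonneg_of_le_pi (by linarith) (by linarith [Complex.arg_le_pi z])
  have h4 : ‖z‖ * sin (z.arg - u) = - (a * sin u) := by
    rw [sin_sub]
    linear_combination cos u * h2 - sin u * h1
  have : 0 ≤ ‖z‖ * sin (z.arg - u) := by positivity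
  have : 0 < a * sin u := by positivity
  linarith

lemma cone (φ ψ a b : ℝ) (h : φ < ψ) (h' : ψ - φ < π) (ha : 0 < a) (hb : 0 < b) :
    ∃ r θ : ℝ, 0 < r ∧ r ≤ a + b ∧ φ < θ ∧ θ < ψ ∧ a * cos φ + b * cos ψ = r * cos θ ∧
      a * sin φ + b * sin ψ = r * sin θ := by
  obtain ⟨r, θ, hr, h0, h1, h2, h3⟩ := cone_aux (ψ - φ) a b (by linarith) h' ha hb
  have e1 : cos ψ = cos φ * cos (ψ - φ) - sin φ * sin (ψ - φ) := by
    rw [← cos_add]; congr 1; ring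
  have e2 : sin ψ = sin φ * cos (ψ - φ) + cos φ * sin (ψ - φ) := by
    rw [← sin_add]; congr 1; ring
  have e3 : a * cos φ + b * cos ψ = r * cos (φ + θ) := by
    rw [e1, cos_add]; linear_combination cos φ * h2 - sin φ * h3
  have e4 : a * sin φ + b * sin ψ = r * sin (φ + θ) := by
    rw [e2, sin_add]; linear_combination sin φ * h2 + cos φ * h3
  refine ⟨r, φ + θ, hr, ?_, by linarith, by linarith, e3, e4⟩
  have : r = a * cos (φ - (φ + θ)) + b * cos (ψ - (φ + θ)) := by
    rw [cos_sub, cos_sub]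
    linear_combination cos (φ + θ) * (-e3) - sin (φ + θ) * e4 - r * sin_sq_add_cos_sq (φ + θ)
  rw [this]
  have := cos_le_one (φ - (φ + θ))
  have := cos_le_one (ψ - (φ + θ))
  nlinarith

lemma ray (φ ψ b : ℝ) (h : φ < ψ) (h' : ψ - φ < π) (hb : 0 < b) (t : ℝ) (ht : t ∈ Icc (0:ℝ) 1) :
    ∃ r θ : ℝ, 0 < r ∧ r ≤ 1 + b ∧ φ ≤ θ ∧ θ ≤ ψ ∧ (t < 1 → θ < ψ) ∧ ∀ s,
      wmap (cos φ) (sin φ) (b * cos ψ - cos φ) (b * sin ψ - sin φ) (s, t) =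
        (s * r * cos θ, s * r * sin θ) := by
  obtain ⟨t0, t1⟩ := ht
  rcases t0.eq_or_lt with rfl | t0
  · exact ⟨1, φ, one_pos, by linarith, le_rfl, h.le, fun _ => h, fun s => by simp [wmap]⟩
  rcases t1.eq_or_lt with rfl | t1
  · exact ⟨b, ψ, hb, by linarith, h.le, le_rfl, fun h => absurd h (lt_irrefl _),
      fun s => by simp [wmap, mul_assoc]⟩
  obtain ⟨r, θ, hr, hr', h1, h2, h3, h4⟩ := cone φ ψ (1 - t) (t * b) h h' (by linarith) (by positivity)
  refine ⟨r, θ, hr, by nlinarith, h1.le, h2.le, fun _ => h2, fun s => ?_⟩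
  simp only [wmap, Prod.mk.injEq]
  constructor
  · rw [mul_assoc, ← h3]; ring
  · rw [mul_assoc, ← h4]; ring

lemma wedge_in (α δ φ ψ b s t : ℝ) (h : φ < ψ) (h' : ψ - φ < π) (hb : 0 < b) (hφ : -α < φ)
    (hψ : ψ ≤ α) (ht : t ∈ Icc (0:ℝ) 1) (ht' : t < 1 ∨ ψ < α) (hs : 0 < s) (hs' : s * (1 + b) < δ) :
    wmap (cos φ) (sin φ) (b * cos ψ - cos φ) (b * sin ψ - sin φ) (s, t) ∈ sector α δ := by
  obtain ⟨r, θ, hr, hr', h1, h2, h3, h4⟩ := ray φ ψ b h h' hb t ht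
  refine ⟨s * r, θ, by positivity, by nlinarith, by linarith, ?_, h4 s⟩
  rcases ht' with ht' | ht'
  · linarith [h3 ht']
  · linarith

lemma sol_C2 {α δ κ lam₀ : ℝ} {γp γm : ℝ → ℝ} {f : ℝ × ℝ → ℝ} (hα : α ∈ Ioo 0 π)
    (hsol : IsCapillarySolution α δ κ lam₀ γp γm f) {z : ℝ × ℝ} (hz : z ∈ sector α δ) :
    ContDiffAt ℝ 2 f z := hsol.smooth.contDiffAt ((sector_open α δ hα).mem_nhds hz)

lemma wedge_C1 {α δ κ lam₀ : ℝ} {γp γm : ℝ → ℝ} {f : ℝ × ℝ → ℝ} (hα : α ∈ Ioo 0 π)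
    (hsol : IsCapillarySolution α δ κ lam₀ γp γm f) (φ ψ b s t : ℝ) (h : φ < ψ) (h' : ψ - φ < π)
    (hb : 0 < b) (hφ : -α < φ)
    (hψ : ψ ≤ α) (ht : t ∈ Icc (0:ℝ) 1) (hs : 0 < s) (hs' : s * (1 + b) < δ) :
    ContDiffAt ℝ 1 f (wmap (cos φ) (sin φ) (b * cos ψ - cos φ) (b * sin ψ - sin φ) (s, t)) := by
  by_cases ht' : t < 1 ∨ ψ < α
  · exact (sol_C2 hα hsol (wedge_in α δ φ ψ b s t h h' hb hφ hψ ht ht' hs hs')).of_le (by norm_num)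
  · push Not at ht'
    have e1 : t = 1 := le_antisymm ht.2 ht'.1
    have e2 : ψ = α := le_antisymm hψ ht'.2
    have := hsol.edgeP_smooth (s * b) ⟨by positivity, by nlinarith⟩
    rw [e1, e2]
    convert this using 1
    simp [wmap, mul_assoc]

lemma grad_Tf_lower (f : ℝ × ℝ → ℝ) (z : ℝ × ℝ) :
    Real.sqrt ((grad f z).1 ^ 2 + (grad f z).2 ^ 2) - 1 ≤
      (grad f z).1 * (Tf f z).1 + (grad f z).2 * (Tf f z).2 := by
  simp only [Tf]
  set x := (grad f z).1
  set y := (grad f z).2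
  have hW := W_pos x y
  set W := Real.sqrt (1 + x ^ 2 + y ^ 2) with hWd
  have hW2 : W ^ 2 = 1 + x ^ 2 + y ^ 2 := Real.sq_sqrt (by positivity)
  set g := Real.sqrt (x ^ 2 + y ^ 2) with hg
  have hg0 : 0 ≤ g := Real.sqrt_nonneg _
  have hg2 : g ^ 2 = x ^ 2 + y ^ 2 := Real.sq_sqrt (by positivity)
  have e : x * (x / W) + y * (y / W) = g ^ 2 / W := by rw [hg2]; field_simp
  rw [e, le_div_iff₀ hW]
  have h1 : W ≤ 1 + g := by nlinarith
  have h2 : g ≤ W := by nlinarith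
  nlinarith

lemma dot_lower (x y d1 d2 : ℝ) :
    -(Real.sqrt (d1 ^ 2 + d2 ^ 2) * Real.sqrt (x ^ 2 + y ^ 2)) ≤ d1 * x + d2 * y := by
  rw [← Real.sqrt_mul (by positivity)]
  apply neg_le_of_abs_le
  apply Real.abs_le_sqrt
  nlinarith [sq_nonneg (d1 * y - d2 * x)]

/-- flux density through the ray of angle `φ`, towards decreasing angle. -/
def tau (f : ℝ × ℝ → ℝ) (φ s : ℝ) : ℝ :=
  (Tf f (s * cos φ, s * sin φ)).1 * sin φ - (Tf f (s * cos φ, s * sin φ)).2 * cos φ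

lemma tau_le (f : ℝ × ℝ → ℝ) (φ s : ℝ) : |tau f φ s| ≤ 1 := by
  have := cross_le _ _ (cos φ) (sin φ) (Tf_norm f (s * cos φ, s * sin φ))
  simpa [tau] using this

lemma wmap_zero (p1 p2 d1 d2 s : ℝ) : wmap p1 p2 d1 d2 (s, 0) = (s * p1, s * p2) := by
  simp [wmap]

lemma f_bound_prod (κ lam₀ M c a y : ℝ) (h : |y| ≤ M) :
    |(a * y + c) * (κ * y + lam₀)| ≤ (|a| * M + |c|) * (|κ| * M + |lam₀|) := by
  have hM : 0 ≤ M := (abs_nonneg y).trans h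
  rw [abs_mul]
  have h1 : |a * y + c| ≤ |a| * M + |c| := by
    refine (abs_add_le _ _).trans ?_
    rw [abs_mul]; gcongr
  have h2 : |κ * y + lam₀| ≤ |κ| * M + |lam₀| := by
    refine (abs_add_le _ _).trans ?_
    rw [abs_mul]; gcongr
  gcongr

lemma flux_edge {α δ κ lam₀ : ℝ} {γp γm : ℝ → ℝ} {f : ℝ × ℝ → ℝ} (hα : α ∈ Ioo 0 π)
    (hsol : IsCapillarySolution α δ κ lam₀ γp γm f) (φ b : ℝ) (h : φ < α) (h' : α - φ < π)
    (hb : 0 < b) (hφ : -α < φ) :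
    ∃ C : ℝ, 0 ≤ C ∧ ∀ ε ρ : ℝ, 0 < ρ → ρ < ε → ε * (1 + b) < δ →
      (∫ s in ρ..ε, b * cos (γp (b * s))) + (∫ s in ρ..ε, tau f φ s) ≤
        (ε + ρ) * Real.sqrt ((b * cos α - cos φ) ^ 2 + (b * sin α - sin φ) ^ 2) + C * ε ^ 2 := by
  obtain ⟨M, hM⟩ := hsol.bounded
  have hM0 : 0 ≤ |M| := abs_nonneg M
  replace hM : ∀ p ∈ sector α δ, |f p| ≤ |M| := fun p hp => (hM p hp).trans (le_abs_self M)
  set M := |M|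
  set D : ℝ := cos φ * (b * sin α - sin φ) - sin φ * (b * cos α - cos φ) with hD
  set B := (|(0:ℝ)| * M + |(-1:ℝ)|) * (|κ| * M + |lam₀|) with hB
  have hB0 : 0 ≤ B := by positivity
  refine ⟨|D| * B, by positivity, fun ε ρ hρ hρε hε => ?_⟩
  have hε0 : 0 < ε := hρ.trans hρε
  have hin : ∀ s ∈ Icc ρ ε, 0 < s ∧ s * (1 + b) < δ := fun s hs =>
    ⟨hρ.trans_le hs.1, lt_of_le_of_lt (by nlinarith [hs.2]) hε⟩
  have key := cap_wedge f κ lam₀ 0 (-1) 0 (cos φ) (sin φ) (b * cos α - cos φ) (b * sin α - sin φ) ρ ε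
    (ε * (|D| * B)) hρε.le
    (fun x hx => by
      have := hin x.1 ⟨hx.1.1, hx.2.1⟩
      exact wedge_C1 hα hsol φ α b x.1 x.2 h h' hb hφ le_rfl ⟨hx.1.2, hx.2.2⟩ this.1 this.2)
    (fun x hx => by
      have h1 := hin x.1 ⟨hx.1.1.le, hx.1.2.le⟩
      have := wedge_in α δ φ α b x.1 x.2 h h' hb hφ le_rfl ⟨hx.2.1.le, hx.2.2.le⟩ (Or.inl hx.2.2) h1.1 h1.2
      exact ⟨sol_C2 hα hsol this, hsol.pde _ this⟩)
    (fun x hx z hz => by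
      have h1 := hin x.1 ⟨hx.1.1.le, hx.1.2.le⟩
      have := wedge_in α δ φ α b x.1 x.2 h h' hb hφ le_rfl ⟨hx.2.1.le, hx.2.2.le⟩ (Or.inl hx.2.2) h1.1 h1.2
      have hfz : |f z| ≤ M := by rw [hz]; exact hM _ this
      have h2 := f_bound_prod κ lam₀ M (-1) 0 (f z) hfz
      have h3 : |x.1 * D * ((0 * f z + (-1)) * (κ * f z + lam₀))| ≤ ε * |D| * B := by
        rw [abs_mul, abs_mul, abs_of_pos h1.1]
        gcongr
        exact hx.1.2.le
      have h4 := neg_le_of_abs_le h3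
      linarith)
  set dn := Real.sqrt ((b * cos α - cos φ) ^ 2 + (b * sin α - sin φ) ^ 2) with hdn
  have hbd : ∀ r : ℝ, 0 < r → |∫ t in (0:ℝ)..1, r *
      ((0 * f (wmap (cos φ) (sin φ) (b * cos α - cos φ) (b * sin α - sin φ) (r, t)) + -1) *
        (Tf f (wmap (cos φ) (sin φ) (b * cos α - cos φ) (b * sin α - sin φ) (r, t))).1 * (b * sin α - sin φ)
      - (0 * f (wmap (cos φ) (sin φ) (b * cos α - cos φ) (b * sin α - sin φ) (r, t)) + -1) *
        (Tf f (wmap (cos φ) (sin φ) (b * cos α - cos φ) (b * sin α - sin φ) (r, t))).2 * (b * cos α - cos φ))|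
      ≤ r * dn := by
    intro r hr
    have := intervalIntegral.norm_integral_le_of_norm_le_const (a := 0) (b := 1) (C := r * dn)
      (f := fun t => r *
      ((0 * f (wmap (cos φ) (sin φ) (b * cos α - cos φ) (b * sin α - sin φ) (r, t)) + -1) *
        (Tf f (wmap (cos φ) (sin φ) (b * cos α - cos φ) (b * sin α - sin φ) (r, t))).1 * (b * sin α - sin φ)
      - (0 * f (wmap (cos φ) (sin φ) (b * cos α - cos φ) (b * sin α - sin φ) (r, t)) + -1) *
        (Tf f (wmap (cos φ) (sin φ) (b * cos α - cos φ) (b * sin α - sin φ) (r, t))).2 * (b * cos α - cos φ)))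
      (fun t _ => by
        set z := wmap (cos φ) (sin φ) (b * cos α - cos φ) (b * sin α - sin φ) (r, t)
        have := cross_le _ _ (b * cos α - cos φ) (b * sin α - sin φ) (Tf_norm f z)
        rw [Real.norm_eq_abs, abs_mul, abs_of_pos hr]
        gcongr
        refine le_of_eq_of_le ?_ this
        rw [← abs_neg]
        congr 1
        ring)
    simpa using this
  have b1 := (abs_le.1 (hbd ε hε0)).2
  have b2 := (abs_le.1 (hbd ρ hρ)).1
  have i0 : ∫ s in ρ..ε, (0 * f (wmap (cos φ) (sin φ) (b * cos α - cos φ) (b * sin α - sin φ) (s, 0)) +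
          ((0 * f (wmap (cos φ) (sin φ) (b * cos α - cos φ) (b * sin α - sin φ) (s, 0)) + -1) *
            (Tf f (wmap (cos φ) (sin φ) (b * cos α - cos φ) (b * sin α - sin φ) (s, 0))).2 *
              (cos φ + 0 * (b * cos α - cos φ))
          - (0 * f (wmap (cos φ) (sin φ) (b * cos α - cos φ) (b * sin α - sin φ) (s, 0)) + -1) *
            (Tf f (wmap (cos φ) (sin φ) (b * cos α - cos φ) (b * sin α - sin φ) (s, 0))).1 *
            (sin φ + 0 * (b * sin α - sin φ)))) = ∫ s in ρ..ε, tau f φ s := by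
    apply intervalIntegral.integral_congr
    intro s _
    simp only [tau, wmap_zero]
    ring
  have i1 : ∫ s in ρ..ε, (0 * f (wmap (cos φ) (sin φ) (b * cos α - cos φ) (b * sin α - sin φ) (s, 1)) +
          ((0 * f (wmap (cos φ) (sin φ) (b * cos α - cos φ) (b * sin α - sin φ) (s, 1)) + -1) *
            (Tf f (wmap (cos φ) (sin φ) (b * cos α - cos φ) (b * sin α - sin φ) (s, 1))).2 *
              (cos φ + 1 * (b * cos α - cos φ))
          - (0 * f (wmap (cos φ) (sin φ) (b * cos α - cos φ) (b * sin α - sin φ) (s, 1)) + -1) *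
            (Tf f (wmap (cos φ) (sin φ) (b * cos α - cos φ) (b * sin α - sin φ) (s, 1))).1 *
            (sin φ + 1 * (b * sin α - sin φ)))) = - ∫ s in ρ..ε, b * cos (γp (b * s)) := by
    rw [← intervalIntegral.integral_neg]
    apply intervalIntegral.integral_congr
    intro s hs
    rw [uIcc_of_le hρε.le] at hs
    obtain ⟨h1, h2⟩ := hin s hs
    have := hsol.bcP (b * s) ⟨by positivity, by nlinarith⟩
    have e : wmap (cos φ) (sin φ) (b * cos α - cos φ) (b * sin α - sin φ) (s, 1) =
        (b * s * cos α, b * s * sin α) := by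
      simp only [wmap, Prod.mk.injEq]; constructor <;> ring
    simp only [e, ← this, dot]
    ring
  rw [i0, i1] at key
  have : ε * (|D| * B) * (ε - ρ) ≤ |D| * B * ε ^ 2 := by
    have : 0 ≤ ε * (|D| * B) * ρ := by positivity
    nlinarith
  linarith

lemma cont_s {f : ℝ × ℝ → ℝ} (p1 p2 d1 d2 t : ℝ) (S : Set ℝ)
    (hc : ∀ s ∈ S, ContDiffAt ℝ 1 f (wmap p1 p2 d1 d2 (s, t))) :
    ContinuousOn (fun s => f (wmap p1 p2 d1 d2 (s, t))) S ∧
    ContinuousOn (fun s => (Tf f (wmap p1 p2 d1 d2 (s, t))).1) S ∧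
    ContinuousOn (fun s => (Tf f (wmap p1 p2 d1 d2 (s, t))).2) S := by
  have hΦ : Continuous (fun s => wmap p1 p2 d1 d2 (s, t)) :=
    (wmap_cont _ _ _ _).comp (by fun_prop)
  exact ⟨fun s hs => (ContinuousAt.comp (f := fun s => wmap p1 p2 d1 d2 (s, t))
      (hc s hs).continuousAt hΦ.continuousAt).continuousWithinAt,
    fun s hs => (ContinuousAt.comp (f := fun s => wmap p1 p2 d1 d2 (s, t))
      (Tf_cont (hc s hs)).1 hΦ.continuousAt).continuousWithinAt,
    fun s hs => (ContinuousAt.comp (f := fun s => wmap p1 p2 d1 d2 (s, t))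
      (Tf_cont (hc s hs)).2 hΦ.continuousAt).continuousWithinAt⟩

lemma cont_t {f : ℝ × ℝ → ℝ} (p1 p2 d1 d2 s : ℝ) (S : Set ℝ)
    (hc : ∀ t ∈ S, ContDiffAt ℝ 1 f (wmap p1 p2 d1 d2 (s, t))) :
    ContinuousOn (fun t => f (wmap p1 p2 d1 d2 (s, t))) S ∧
    ContinuousOn (fun t => (Tf f (wmap p1 p2 d1 d2 (s, t))).1) S ∧
    ContinuousOn (fun t => (Tf f (wmap p1 p2 d1 d2 (s, t))).2) S := by
  have hΦ : Continuous (fun t => wmap p1 p2 d1 d2 (s, t)) :=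
    (wmap_cont _ _ _ _).comp (by fun_prop)
  exact ⟨fun t ht => (ContinuousAt.comp (f := fun t => wmap p1 p2 d1 d2 (s, t))
      (hc t ht).continuousAt hΦ.continuousAt).continuousWithinAt,
    fun t ht => (ContinuousAt.comp (f := fun t => wmap p1 p2 d1 d2 (s, t))
      (Tf_cont (hc t ht)).1 hΦ.continuousAt).continuousWithinAt,
    fun t ht => (ContinuousAt.comp (f := fun t => wmap p1 p2 d1 d2 (s, t))
      (Tf_cont (hc t ht)).2 hΦ.continuousAt).continuousWithinAt⟩

lemma arc_bound {α δ κ lam₀ : ℝ} {γp γm : ℝ → ℝ} {f : ℝ × ℝ → ℝ} {R : ℝ → ℝ} (hα : α ∈ Ioo 0 π)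
    (hδ : 0 < δ)
    (hsol : IsCapillarySolution α δ κ lam₀ γp γm f)
    (hR : ∀ θ ∈ Ioo (-α) α, RadialLimitAt f θ (R θ)) (φ ψ : ℝ) (h : φ < ψ) (h' : ψ - φ < π)
    (hφ : -α < φ) (hψ : ψ < α) (hanti : ∀ θ ∈ Icc φ ψ, R ψ ≤ R θ ∧ R θ ≤ R φ) (μ : ℝ) (hμ : 0 < μ) :
    ∀ᶠ ε in 𝓝[>] (0:ℝ), ∫ t in (0:ℝ)..1,
      |f (wmap (cos φ) (sin φ) (1 * cos ψ - cos φ) (1 * sin ψ - sin φ) (ε, t)) - R ψ| ≤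
        R φ - R ψ + μ := by
  obtain ⟨M, hM⟩ := hsol.bounded
  have hsmall : ∀ᶠ ε in 𝓝[>] (0:ℝ), 0 < ε ∧ ε * (1 + 1) < δ := by
    have : Ioo (0:ℝ) (δ / 2) ∈ 𝓝[>] (0:ℝ) := Ioo_mem_nhdsGT (by positivity)
    filter_upwards [this] with ε hε
    exact ⟨hε.1, by linarith [hε.2]⟩
  set z : ℝ → ℝ → ℝ × ℝ := fun ε t =>
    wmap (cos φ) (sin φ) (1 * cos ψ - cos φ) (1 * sin ψ - sin φ) (ε, t) with hz
  have hcont : ∀ ε, 0 < ε → ε * (1 + 1) < δ → ContinuousOn (fun t => f (z ε t)) (Icc 0 1) :=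
    fun ε h1 h2 => (cont_t _ _ _ _ ε (Icc 0 1) (fun t ht =>
      wedge_C1 hα hsol φ ψ 1 ε t h h' one_pos hφ hψ.le ht h1 h2)).1
  set g : ℝ → ℝ → ℝ := fun ε t => max (|f (z ε t) - R ψ| - (R φ - R ψ)) 0 with hg
  have hgc : ∀ ε, 0 < ε → ε * (1 + 1) < δ → ContinuousOn (g ε) (Icc 0 1) := fun ε h1 h2 =>
    (((hcont ε h1 h2).sub continuousOn_const).abs.sub continuousOn_const).sup continuousOn_const
  have hΔ : 0 ≤ R φ - R ψ := by linarith [(hanti φ ⟨le_rfl, h.le⟩).1]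
  have hlim : Tendsto (fun ε => ∫ t in (0:ℝ)..1, g ε t) (𝓝[>] 0) (𝓝 (∫ t in (0:ℝ)..1, (0:ℝ))) := by
    apply intervalIntegral.tendsto_integral_filter_of_dominated_convergence (fun _ => M + |R ψ|)
    · filter_upwards [hsmall] with ε hε
      rw [uIoc_of_le zero_le_one]
      exact ((hgc ε hε.1 hε.2).mono Ioc_subset_Icc_self).aestronglyMeasurable measurableSet_Ioc
    · filter_upwards [hsmall] with ε hε
      refine Eventually.of_forall fun t ht => ?_
      rw [uIoc_of_le zero_le_one] at ht
      have hin := hM _ (wedge_in α δ φ ψ 1 ε t h h' one_pos hφ hψ.le ⟨ht.1.le, ht.2⟩ (Or.inr hψ) hε.1 hε.2)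
      rw [Real.norm_eq_abs, abs_of_nonneg (le_max_right _ _)]
      have h1 : |f (z ε t) - R ψ| ≤ M + |R ψ| := (abs_sub _ _).trans (by gcongr)
      exact max_le (by linarith) ((abs_nonneg _).trans h1)
    · exact intervalIntegrable_const
    · refine Eventually.of_forall fun t ht => ?_
      rw [uIoc_of_le zero_le_one] at ht
      obtain ⟨r, θ, hr, -, h1, h2, -, h4⟩ := ray φ ψ 1 h h' one_pos t ⟨ht.1.le, ht.2⟩
      have hRθ := hR θ ⟨by linarith, by linarith⟩
      have hsc : Tendsto (fun ε : ℝ => ε * r) (𝓝[>] 0) (𝓝[>] 0) := by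
        apply tendsto_nhdsWithin_of_tendsto_nhds_of_eventually_within
        · have : Tendsto (fun ε : ℝ => ε * r) (𝓝 0) (𝓝 (0 * r)) :=
            (continuous_id.mul continuous_const).tendsto 0
          rw [zero_mul] at this
          exact this.mono_left nhdsWithin_le_nhds
        · filter_upwards [self_mem_nhdsWithin] with ε hε
          exact mul_pos hε hr
      have h5 : Tendsto (fun ε => f (z ε t)) (𝓝[>] 0) (𝓝 (R θ)) := by
        have := hRθ.comp hsc
        refine this.congr fun ε => ?_
        simp only [Function.comp, hz, h4]
      have h6 : Tendsto (fun ε => g ε t) (𝓝[>] 0) (𝓝 (max (|R θ - R ψ| - (R φ - R ψ)) 0)) :=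
        (((h5.sub tendsto_const_nhds).abs).sub tendsto_const_nhds).max tendsto_const_nhds
      obtain ⟨h7, h8⟩ := hanti θ ⟨h1, h2⟩
      rwa [max_eq_right] at h6
      rw [abs_of_nonneg (by linarith)]
      linarith
  rw [intervalIntegral.integral_zero] at hlim
  filter_upwards [hlim.eventually (gt_mem_nhds hμ), hsmall] with ε h1 h2
  have hm : ∫ t in (0:ℝ)..1, |f (z ε t) - R ψ| ≤ ∫ t in (0:ℝ)..1, ((R φ - R ψ) + g ε t) := by
    apply intervalIntegral.integral_mono_on zero_le_one
    · apply ContinuousOn.intervalIntegrable_of_Icc zero_le_one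
      exact ((hcont ε h2.1 h2.2).sub continuousOn_const).abs
    · apply ContinuousOn.intervalIntegrable_of_Icc zero_le_one
      exact continuousOn_const.add (hgc ε h2.1 h2.2)
    · intro t _
      have := le_max_left (|f (z ε t) - R ψ| - (R φ - R ψ)) 0
      simp only [hg]
      linarith
  rw [intervalIntegral.integral_add intervalIntegrable_const
    (ContinuousOn.intervalIntegrable_of_Icc zero_le_one (hgc ε h2.1 h2.2))] at hm
  simp only [intervalIntegral.integral_const, sub_zero, one_smul] at hm
  linarith

set_option maxHeartbeats 1000000 in
lemma flux_fan {α δ κ lam₀ : ℝ} {γp γm : ℝ → ℝ} {f : ℝ × ℝ → ℝ} {R : ℝ → ℝ} (hα : α ∈ Ioo 0 π)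
    (hδ : 0 < δ)
    (hsol : IsCapillarySolution α δ κ lam₀ γp γm f)
    (hR : ∀ θ ∈ Ioo (-α) α, RadialLimitAt f θ (R θ)) (φ ψ : ℝ) (h : φ < ψ) (h' : ψ - φ < π)
    (hφ : -α < φ) (hψ : ψ < α) (hanti : ∀ θ ∈ Icc φ ψ, R ψ ≤ R θ ∧ R θ ≤ R φ)
    (k dn : ℝ) (hk : 0 ≤ k)
    (hdn : dn = Real.sqrt ((1 * cos ψ - cos φ) ^ 2 + (1 * sin ψ - sin φ) ^ 2))
    (hkd : k * dn = cos φ * (1 * sin ψ - sin φ) - sin φ * (1 * cos ψ - cos φ))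
    (μ : ℝ) (hμ : 0 < μ) :
    ∃ C : ℝ, ∀ᶠ ε in 𝓝[>] (0:ℝ), ∀ ρ : ℝ, 0 < ρ → ρ < ε →
      ε * ((R φ - R ψ) * (k - dn) - μ * (2 * (k + 1) + dn + 1)) - C * ρ ≤
        (R φ - R ψ) * ∫ s in ρ..ε, tau f φ s := by
  have hdn0 : 0 ≤ dn := by rw [hdn]; positivity
  obtain ⟨M, hM⟩ := hsol.bounded
  have hM0 : 0 ≤ |M| := abs_nonneg M
  replace hM : ∀ p ∈ sector α δ, |f p| ≤ |M| := fun p hp => (hM p hp).trans (le_abs_self M)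
  set M := |M|
  set c := R ψ with hc
  set Δ := R φ - c with hΔ
  have hΔ0 : 0 ≤ Δ := by linarith [(hanti φ ⟨le_rfl, h.le⟩).1]
  set D : ℝ := cos φ * (1 * sin ψ - sin φ) - sin φ * (1 * cos ψ - cos φ) with hD
  have hD0 : 0 ≤ D := by rw [← hkd]; positivity
  set B := (|(1:ℝ)| * M + |-c|) * (|κ| * M + |lam₀|) with hB
  have hB0 : 0 ≤ B := by positivity
  set Z : ℝ × ℝ → ℝ × ℝ := wmap (cos φ) (sin φ) (1 * cos ψ - cos φ) (1 * sin ψ - sin φ) with hZ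
  refine ⟨k * Δ + (M + |c|) * dn, ?_⟩
  -- eventual facts
  have ev1 : ∀ᶠ ε in 𝓝[>] (0:ℝ), 0 < ε ∧ ε * (1 + 1) < δ ∧ ε * (D * (1 + B)) ≤ μ := by
    have h1 : Ioo (0:ℝ) (δ / 2) ∈ 𝓝[>] (0:ℝ) := Ioo_mem_nhdsGT (by positivity)
    have h2 : Ioo (0:ℝ) (μ / (D * (1 + B) + 1)) ∈ 𝓝[>] (0:ℝ) := Ioo_mem_nhdsGT (by positivity)
    filter_upwards [h1, h2] with ε h1 h2
    refine ⟨h1.1, by linarith [h1.2], ?_⟩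
    have := h2.2
    rw [lt_div_iff₀ (by positivity)] at this
    linarith [h1.1]
  have ev2 : ∀ θ ∈ Ioo (-α) α, ∀ᶠ ε in 𝓝[>] (0:ℝ), ∀ s, 0 < s → s ≤ ε →
      |f (s * cos θ, s * sin θ) - R θ| ≤ μ := by
    intro θ hθ
    have h1 : ∀ᶠ s in 𝓝[>] (0:ℝ), |f (s * cos θ, s * sin θ) - R θ| < μ := by
      have := (Metric.tendsto_nhds.1 (hR θ hθ)) μ hμ
      simpa only [Real.dist_eq] using this
    obtain ⟨u, hu, hu'⟩ := mem_nhdsGT_iff_exists_Ioo_subset.1 h1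
    have h2 : Ioo (0:ℝ) u ∈ 𝓝[>] (0:ℝ) := Ioo_mem_nhdsGT hu
    filter_upwards [h2] with ε hε s hs hs'
    exact le_of_lt (hu' (a := s) ⟨hs, hs'.trans_lt hε.2⟩)
  filter_upwards [ev1, ev2 φ ⟨hφ, by linarith⟩, ev2 ψ ⟨by linarith, hψ⟩,
    arc_bound hα hδ hsol hR φ ψ h h' hφ hψ hanti μ hμ] with ε e1 e2 e3 e4 ρ hρ hρε
  obtain ⟨hε0, hε, hεK⟩ := e1
  have hin : ∀ s ∈ Icc ρ ε, 0 < s ∧ s * (1 + 1) < δ := fun s hs =>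
    ⟨hρ.trans_le hs.1, lt_of_le_of_lt (by nlinarith [hs.2]) hε⟩
  have hC1 : ∀ s ∈ Icc ρ ε, ∀ t ∈ Icc (0:ℝ) 1, ContDiffAt ℝ 1 f (Z (s, t)) := fun s hs t ht =>
    wedge_C1 hα hsol φ ψ 1 s t h h' one_pos hφ hψ.le ht (hin s hs).1 (hin s hs).2
  have hsec : ∀ s ∈ Icc ρ ε, ∀ t ∈ Icc (0:ℝ) 1, Z (s, t) ∈ sector α δ := fun s hs t ht =>
    wedge_in α δ φ ψ 1 s t h h' one_pos hφ hψ.le ht (Or.inr hψ) (hin s hs).1 (hin s hs).2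
  have key := cap_wedge f κ lam₀ 1 (-c) k (cos φ) (sin φ) (1 * cos ψ - cos φ) (1 * sin ψ - sin φ) ρ ε
    (ε * (D * (1 + B))) hρε.le
    (fun x hx => hC1 x.1 ⟨hx.1.1, hx.2.1⟩ x.2 ⟨hx.1.2, hx.2.2⟩)
    (fun x hx => by
      have := hsec x.1 ⟨hx.1.1.le, hx.1.2.le⟩ x.2 ⟨hx.2.1.le, hx.2.2.le⟩
      exact ⟨sol_C2 hα hsol this, hsol.pde _ this⟩)
    (fun x hx z hz => by
      have hx1 := (hin x.1 ⟨hx.1.1.le, hx.1.2.le⟩).1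
      have := hsec x.1 ⟨hx.1.1.le, hx.1.2.le⟩ x.2 ⟨hx.2.1.le, hx.2.2.le⟩
      have hfz : |f z| ≤ M := by rw [hz]; exact hM _ this
      have h2 := neg_le_of_abs_le (f_bound_prod κ lam₀ M (-c) 1 (f z) hfz)
      have h3 := grad_Tf_lower f z
      have h4 := dot_lower (grad f z).1 (grad f z).2 (1 * cos ψ - cos φ) (1 * sin ψ - sin φ)
      rw [← hdn] at h4
      have h5 := mul_le_mul_of_nonneg_left h4 hk
      have h6 : D * (Real.sqrt ((grad f z).1 ^ 2 + (grad f z).2 ^ 2) - 1 + -B) ≤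
        D * (1 * ((grad f z).1 * (Tf f z).1 + (grad f z).2 * (Tf f z).2)
          + (1 * f z + -c) * (κ * f z + lam₀)) := by
        apply mul_le_mul_of_nonneg_left _ hD0
        linarith
      have h7 : -(D * (1 + B)) ≤ D * (1 * ((grad f z).1 * (Tf f z).1 + (grad f z).2 * (Tf f z).2)
          + (1 * f z + -c) * (κ * f z + lam₀)) + k * ((1 * cos ψ - cos φ) * (grad f z).1 +
            (1 * sin ψ - sin φ) * (grad f z).2) := by
        have : k * -(dn * Real.sqrt ((grad f z).1 ^ 2 + (grad f z).2 ^ 2)) =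
          - (D * Real.sqrt ((grad f z).1 ^ 2 + (grad f z).2 ^ 2)) := by rw [← hkd]; ring
        rw [this] at h5
        linarith
      have h8 := mul_le_mul_of_nonneg_left h7 hx1.le
      have h9 : x.1 * (D * (1 + B)) ≤ ε * (D * (1 + B)) :=
        mul_le_mul_of_nonneg_right hx.1.2.le (by positivity)
      linarith)
  rw [← hZ] at key
  have m0 : (0:ℝ) ∈ Icc (0:ℝ) 1 := ⟨le_rfl, zero_le_one⟩
  have m1 : (1:ℝ) ∈ Icc (0:ℝ) 1 := ⟨zero_le_one, le_rfl⟩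
  have Z0 : ∀ s, Z (s, 0) = (s * cos φ, s * sin φ) := fun s => by simp [hZ, wmap]
  have Z1 : ∀ s, Z (s, 1) = (s * cos ψ, s * sin ψ) := fun s => by simp [hZ, wmap]
  obtain ⟨p0, p1, p2⟩ := cont_s (f := f) _ _ _ _ 0 (Icc ρ ε) (fun s hs => hC1 s hs 0 m0)
  obtain ⟨q0, q1, q2⟩ := cont_s (f := f) _ _ _ _ 1 (Icc ρ ε) (fun s hs => hC1 s hs 1 m1)
  obtain ⟨r0, r1, r2⟩ := cont_t (f := f) _ _ _ _ ε (Icc 0 1) (fun t ht => hC1 ε ⟨hρε.le, le_rfl⟩ t ht)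
  rw [← hZ] at p0 p1 p2 q0 q1 q2 r0 r1 r2
  have ctau : ContinuousOn (tau f φ) (Icc ρ ε) := by
    have : tau f φ = fun s => (Tf f (Z (s, 0))).1 * sin φ - (Tf f (Z (s, 0))).2 * cos φ := by
      funext s; simp only [tau, Z0]
    rw [this]
    exact (p1.mul continuousOn_const).sub (p2.mul continuousOn_const)
  have itau : IntervalIntegrable (tau f φ) volume ρ ε :=
    ContinuousOn.intervalIntegrable_of_Icc hρε.le ctau
  -- first term
  have t1 : (∫ s in ρ..ε, (k * f (Z (s, 1)) + ((1 * f (Z (s, 1)) + -c) * (Tf f (Z (s, 1))).2 *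
      (cos φ + 1 * (1 * cos ψ - cos φ)) - (1 * f (Z (s, 1)) + -c) * (Tf f (Z (s, 1))).1 *
      (sin φ + 1 * (1 * sin ψ - sin φ))))) ≤ ∫ s in ρ..ε, (k * c + (k + 1) * μ) := by
    apply intervalIntegral.integral_mono_on hρε.le _ intervalIntegrable_const
    · intro s hs
      have h1 := e3 s (hin s hs).1 hs.2
      have h2 := tau_le f ψ s
      have h3 : |(f (s * cos ψ, s * sin ψ) - c) * tau f ψ s| ≤ μ * 1 := by
        rw [abs_mul]; gcongr
      have h4 := mul_le_mul_of_nonneg_left (abs_le.1 h1).2 hk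
      have h5 := (abs_le.1 h3).1
      rw [Z1]
      simp only [tau] at h5
      linarith
    · apply ContinuousOn.intervalIntegrable_of_Icc hρε.le
      exact (continuousOn_const.mul q0).add
        (((((continuousOn_const.mul q0).add continuousOn_const).mul q2).mul continuousOn_const).sub
        ((((continuousOn_const.mul q0).add continuousOn_const).mul q1).mul continuousOn_const))
  have t2 : ∫ s in ρ..ε, ((k * (c + Δ) - (k + 1) * μ) - Δ * tau f φ s) ≤
      (∫ s in ρ..ε, (k * f (Z (s, 0)) + ((1 * f (Z (s, 0)) + -c) * (Tf f (Z (s, 0))).2 *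
      (cos φ + 0 * (1 * cos ψ - cos φ)) - (1 * f (Z (s, 0)) + -c) * (Tf f (Z (s, 0))).1 *
      (sin φ + 0 * (1 * sin ψ - sin φ))))) := by
    apply intervalIntegral.integral_mono_on hρε.le
    · exact intervalIntegrable_const.sub (itau.const_mul _)
    · apply ContinuousOn.intervalIntegrable_of_Icc hρε.le
      exact (continuousOn_const.mul p0).add
        (((((continuousOn_const.mul p0).add continuousOn_const).mul p2).mul continuousOn_const).sub
        ((((continuousOn_const.mul p0).add continuousOn_const).mul p1).mul continuousOn_const))
    · intro s hs
      have h1 := e2 s (hin s hs).1 hs.2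
      have h2 := tau_le f φ s
      have h3 : |(f (s * cos φ, s * sin φ) - R φ) * tau f φ s| ≤ μ * 1 := by
        rw [abs_mul]; gcongr
      have h4 := mul_le_mul_of_nonneg_left (abs_le.1 h1).1 hk
      have h5 := (abs_le.1 h3).2
      have h6 : R φ = c + Δ := by rw [hΔ]; ring
      rw [h6] at h4 h5
      rw [Z0]
      simp only [tau] at h5 ⊢
      linarith
  rw [intervalIntegral.integral_sub intervalIntegrable_const (itau.const_mul _),
    intervalIntegral.integral_const_mul] at t2
  have hcr : ∀ x : ℝ × ℝ, |(1 * f (Z x) + -c) * (Tf f (Z x)).1 * (1 * sin ψ - sin φ) -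
        (1 * f (Z x) + -c) * (Tf f (Z x)).2 * (1 * cos ψ - cos φ)| ≤ dn * |f (Z x) - c| := by
    intro x
    have h1 := cross_le _ _ (1 * cos ψ - cos φ) (1 * sin ψ - sin φ) (Tf_norm f (Z x))
    rw [← hdn] at h1
    have : (1 * f (Z x) + -c) * (Tf f (Z x)).1 * (1 * sin ψ - sin φ) -
        (1 * f (Z x) + -c) * (Tf f (Z x)).2 * (1 * cos ψ - cos φ) =
      ((Tf f (Z x)).1 * (1 * sin ψ - sin φ) - (Tf f (Z x)).2 * (1 * cos ψ - cos φ)) * (f (Z x) - c) := by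
      ring
    rw [this, abs_mul]
    gcongr
  have t3 : ∫ t in (0:ℝ)..1, ε * ((1 * f (Z (ε, t)) + -c) * (Tf f (Z (ε, t))).1 * (1 * sin ψ - sin φ) -
        (1 * f (Z (ε, t)) + -c) * (Tf f (Z (ε, t))).2 * (1 * cos ψ - cos φ)) ≤
      ∫ t in (0:ℝ)..1, (ε * dn) * |f (Z (ε, t)) - c| := by
    apply intervalIntegral.integral_mono_on zero_le_one
    · apply ContinuousOn.intervalIntegrable_of_Icc zero_le_one
      exact continuousOn_const.mul
        (((((continuousOn_const.mul r0).add continuousOn_const).mul r1).mul continuousOn_const).sub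
        ((((continuousOn_const.mul r0).add continuousOn_const).mul r2).mul continuousOn_const))
    · apply ContinuousOn.intervalIntegrable_of_Icc zero_le_one
      exact continuousOn_const.mul (r0.sub continuousOn_const).abs
    · intro t _
      rw [mul_assoc ε dn]
      exact mul_le_mul_of_nonneg_left ((le_abs_self _).trans (hcr (ε, t))) hε0.le
  rw [intervalIntegral.integral_const_mul (ε * dn)] at t3
  have t3' : ε * dn * ∫ t in (0:ℝ)..1, |f (Z (ε, t)) - c| ≤ ε * dn * (Δ + μ) :=
    mul_le_mul_of_nonneg_left e4 (mul_nonneg hε0.le hdn0)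
  have t4 : |∫ t in (0:ℝ)..1, ρ * ((1 * f (Z (ρ, t)) + -c) * (Tf f (Z (ρ, t))).1 * (1 * sin ψ - sin φ) -
        (1 * f (Z (ρ, t)) + -c) * (Tf f (Z (ρ, t))).2 * (1 * cos ψ - cos φ))| ≤
      ρ * (dn * (M + |c|)) := by
    have := intervalIntegral.norm_integral_le_of_norm_le_const (a := 0) (b := 1)
      (C := ρ * (dn * (M + |c|)))
      (f := fun t => ρ * ((1 * f (Z (ρ, t)) + -c) * (Tf f (Z (ρ, t))).1 * (1 * sin ψ - sin φ) -
        (1 * f (Z (ρ, t)) + -c) * (Tf f (Z (ρ, t))).2 * (1 * cos ψ - cos φ)))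
      (fun t ht => by
        rw [uIoc_of_le zero_le_one] at ht
        have h1 := hM _ (hsec ρ ⟨le_rfl, hρε.le⟩ t ⟨ht.1.le, ht.2⟩)
        rw [Real.norm_eq_abs, abs_mul, abs_of_pos hρ]
        refine mul_le_mul_of_nonneg_left ((hcr (ρ, t)).trans ?_) hρ.le
        refine mul_le_mul_of_nonneg_left ((abs_sub _ _).trans ?_) hdn0
        linarith)
    simpa using this
  have t4' := (abs_le.1 t4).1
  simp only [intervalIntegral.integral_const, smul_eq_mul] at t1 t2
  have t5 : (ε * (D * (1 + B))) * (ε - ρ) ≤ μ * ε := by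
    have a1 : (ε * (D * (1 + B))) * (ε - ρ) ≤ μ * (ε - ρ) :=
      mul_le_mul_of_nonneg_right hεK (by linarith)
    have a2 : 0 < μ * ρ := by positivity
    linarith
  have t6 : 0 ≤ (k + 1) * μ * ρ := by positivity
  clear_value D B M c Δ
  linarith

/-- Bound for a decreasing upper side fan: if `Rf` is constant on
`[α₂, α)` and strictly decreasing on `[α₂ − η, α₂] ∩ (−α, α)`, then with `β⁺ = α − α₂`,
for every `λ ∈ (β⁺, π)` one has
`1 + A⁺_S(sin(λ−β⁺)/sin λ) ≤ sin β⁺ / sin λ`. -/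
theorem upper_fan_decreasing_bound
    (α δ κ lam₀ : ℝ) (γp γm : ℝ → ℝ) (f : ℝ × ℝ → ℝ) (R : ℝ → ℝ)
    (hα : α ∈ Ioo 0 π) (hδ : 0 < δ)
    (hsol : IsCapillarySolution α δ κ lam₀ γp γm f)
    (hdisc : DiscontinuousAtCorner α δ f)
    (hR : ∀ θ ∈ Ioo (-α) α, RadialLimitAt f θ (R θ))
    (α₂ η : ℝ) (hα₂ : α₂ ∈ Ioc (-α) α) (hη : 0 < η)
    (hconst : ∃ c : ℝ, ∀ θ ∈ Ico α₂ α, R θ = c)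
    (hanti : StrictAntiOn R (Icc (α₂ - η) α₂ ∩ Ioo (-α) α)) :
    ∀ lam ∈ Ioo (α - α₂) π,
      1 + fanAS γp (Real.sin (lam - (α - α₂)) / Real.sin lam) ≤
        Real.sin (α - α₂) / Real.sin lam := by
  intro lam hlam
  set β := α - α₂ with hβ
  have hβ0 : 0 ≤ β := by linarith [hα₂.2]
  have hsl : 0 < sin lam := sin_pos_of_pos_of_lt_pi (by linarith [hlam.1]) hlam.2
  have hb : 0 < sin (lam - β) / sin lam :=
    div_pos (sin_pos_of_pos_of_lt_pi (by linarith [hlam.1]) (by linarith [hlam.2])) hsl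
  have hnorm : Real.sqrt ((sin (lam - β) / sin lam * cos α - cos α₂) ^ 2 +
      (sin (lam - β) / sin lam * sin α - sin α₂) ^ 2) = sin β / sin lam := by
    have h0 : 0 ≤ sin β / sin lam :=
      div_nonneg (sin_nonneg_of_nonneg_of_le_pi hβ0 (by linarith [hlam.1, hlam.2])) hsl.le
    rw [Real.sqrt_eq_iff_mul_self_eq (by positivity) h0]
    have hcb : cos β = cos α * cos α₂ + sin α * sin α₂ := by rw [hβ, cos_sub]
    have e1 : (sin (lam - β) / sin lam * cos α - cos α₂) ^ 2 +
      (sin (lam - β) / sin lam * sin α - sin α₂) ^ 2 =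
      (sin (lam - β) / sin lam) ^ 2 + 1 - 2 * (sin (lam - β) / sin lam) * cos β := by
      rw [hcb]
      linear_combination (sin (lam - β) / sin lam) ^ 2 * sin_sq_add_cos_sq α + sin_sq_add_cos_sq α₂
    rw [e1]
    field_simp
    rw [sin_sub]
    have h1 := sin_sq_add_cos_sq β
    have h2 := sin_sq_add_cos_sq lam
    linear_combination (-(sin lam) ^ 2) * h1 + (sin β) ^ 2 * h2
  set b := sin (lam - β) / sin lam with hbdef
  suffices H : ∀ ν : ℝ, 0 < ν → fanAS γp b ≤ sin β / sin lam - 1 + ν by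
    have := le_of_forall_pos_le_add H
    linarith
  intro ν hν
  set Ψ : ℝ → ℝ := fun x => Real.sqrt ((b * cos α - cos (α₂ - 2 * x)) ^ 2 +
      (b * sin α - sin (α₂ - 2 * x)) ^ 2) - (cos (x / 2) - 2 * sin (x / 2)) with hΨ
  have hΨc : Continuous Ψ := by rw [hΨ]; fun_prop
  have hΨ0 : Ψ 0 = sin β / sin lam - 1 := by
    simp only [hΨ, mul_zero, sub_zero, zero_div, cos_zero, sin_zero]
    rw [hnorm]
  have hev : ∀ᶠ x in 𝓝[>] (0:ℝ), Ψ x < sin β / sin lam - 1 + ν := by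
    have : Tendsto Ψ (𝓝[>] 0) (𝓝 (Ψ 0)) := (hΨc.tendsto 0).mono_left nhdsWithin_le_nhds
    rw [hΨ0] at this
    exact this.eventually (gt_mem_nhds (by linarith))
  have hm : ∀ y : ℝ, 0 < y → ∀ᶠ x in 𝓝[>] (0:ℝ), x ∈ Ioo 0 y := fun y hy => Ioo_mem_nhdsGT hy
  obtain ⟨x, hx1, hx2, hx3, hx4⟩ := (hev.and ((hm (η / 2) (by linarith)).and
    ((hm ((α₂ + α) / 2) (by linarith [hα₂.1])).and
      (hm ((π - β) / 2) (by linarith [hlam.1, hlam.2]))))).exists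
  have hx0 := hx2.1
  obtain ⟨φ, hφd⟩ : ∃ φ, φ = α₂ - 2 * x := ⟨_, rfl⟩
  obtain ⟨ψ, hψd⟩ : ∃ ψ, ψ = α₂ - x := ⟨_, rfl⟩
  have hφψ : φ < ψ := by linarith
  have hφα : -α < φ := by linarith [hx3.2]
  have hψα : ψ < α := by linarith [hα₂.2]
  have hαφ : α - φ < π := by linarith [hx4.2]
  have hmem : ∀ θ ∈ Icc φ ψ, θ ∈ Icc (α₂ - η) α₂ ∩ Ioo (-α) α := fun θ hθ =>
    ⟨⟨by linarith [hθ.1, hx2.2], by linarith [hθ.2]⟩, ⟨by linarith [hθ.1], by linarith [hθ.2]⟩⟩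
  have hφm : φ ∈ Icc φ ψ := ⟨le_rfl, hφψ.le⟩
  have hψm : ψ ∈ Icc φ ψ := ⟨hφψ.le, le_rfl⟩
  have hΔ : 0 < R φ - R ψ := by
    have := hanti (hmem φ hφm) (hmem ψ hψm) hφψ
    linarith
  have hmono : ∀ θ ∈ Icc φ ψ, R ψ ≤ R θ ∧ R θ ≤ R φ := fun θ hθ =>
    ⟨hanti.antitoneOn (hmem θ hθ) (hmem ψ hψm) hθ.2, hanti.antitoneOn (hmem φ hφm) (hmem θ hθ) hθ.1⟩
  have hxx : ψ - φ = x := by rw [hφd, hψd]; ring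
  have hxπ : x < π := by linarith [hx4.2]
  set k := cos (x / 2) with hk
  set dn := 2 * sin (x / 2) with hdn
  have hk0 : 0 ≤ k := cos_nonneg_of_mem_Icc ⟨by linarith, by linarith⟩
  have hs0 : 0 ≤ sin (x / 2) := sin_nonneg_of_nonneg_of_le_pi (by linarith) (by linarith)
  have hdn0 : 0 ≤ dn := by positivity
  have hcx : cos x = cos ψ * cos φ + sin ψ * sin φ := by rw [← hxx, cos_sub]
  have hsx : sin x = sin ψ * cos φ - cos ψ * sin φ := by rw [← hxx, sin_sub]
  have hc2 : cos x = 1 - 2 * sin (x / 2) ^ 2 := by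
    have := cos_two_mul (x / 2)
    rw [show 2 * (x / 2) = x by ring] at this
    linarith [sin_sq_add_cos_sq (x / 2)]
  have hs2 : sin x = 2 * sin (x / 2) * cos (x / 2) := by
    rw [← sin_two_mul]; congr 1; ring
  have hdn' : dn = Real.sqrt ((1 * cos ψ - cos φ) ^ 2 + (1 * sin ψ - sin φ) ^ 2) := by
    symm
    rw [Real.sqrt_eq_iff_mul_self_eq (by positivity) hdn0]
    rw [hdn]
    linear_combination sin_sq_add_cos_sq ψ + sin_sq_add_cos_sq φ - 2 * hc2 + 2 * hcx
  have hkd : k * dn = cos φ * (1 * sin ψ - sin φ) - sin φ * (1 * cos ψ - cos φ) := by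
    rw [hk, hdn]
    linear_combination hsx - hs2
  have hΨx : Ψ x = Real.sqrt ((b * cos α - cos φ) ^ 2 + (b * sin α - sin φ) ^ 2) - (k - dn) := by
    simp only [hΨ, hφd, hk, hdn]
  set d2 := Real.sqrt ((b * cos α - cos φ) ^ 2 + (b * sin α - sin φ) ^ 2) with hd2
  set ν' := (sin β / sin lam - 1 + ν - Ψ x) / 2 with hν'
  have hν'0 : 0 < ν' := by rw [hν']; linarith
  set E := 2 * (k + 1) + dn + 1 with hE
  have hE0 : 0 < E := by positivity
  obtain ⟨C1, hC1, hedge⟩ := flux_edge hα hsol φ b (by linarith) hαφ hb hφα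
  obtain ⟨C, hfan⟩ := flux_fan hα hδ hsol hR φ ψ hφψ (by linarith) hφα hψα hmono k dn hk0 hdn' hkd
    ((R φ - R ψ) * ν' / E) (by positivity)
  have hcosm : Measurable (fun t => cos (γp t)) := Real.measurable_cos.comp hsol.measurable_γp
  have hii : ∀ u v : ℝ, IntervalIntegrable (fun t => cos (γp t)) volume u v := fun u v => by
    refine (intervalIntegrable_const (c := (1:ℝ))).mono_fun hcosm.aestronglyMeasurable ?_
    exact Eventually.of_forall fun t => by
      simpa using abs_cos_le_one (γp t)
  have hset : ∀ ε : ℝ, 0 < ε → ∫ t in Ioo (0:ℝ) (b * ε), cos (γp t) = ∫ t in (0:ℝ)..(b * ε), cos (γp t) := by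
    intro ε hε
    rw [intervalIntegral.integral_of_le (by positivity), integral_Ioc_eq_integral_Ioo]
  have habs : ∀ ε : ℝ, 0 < ε → |∫ t in (0:ℝ)..(b * ε), cos (γp t)| ≤ b * ε := by
    intro ε hε
    have := intervalIntegral.norm_integral_le_of_norm_le_const (a := 0) (b := b * ε) (C := 1)
      (f := fun t => cos (γp t)) (fun t _ => by simpa using abs_cos_le_one (γp t))
    rwa [Real.norm_eq_abs, sub_zero, abs_of_pos (a := b * ε) (by positivity), one_mul] at this
  have hpos : ∀ᶠ ε in 𝓝[>] (0:ℝ), 0 < ε := self_mem_nhdsWithin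
  unfold fanAS
  refine limsup_le_of_le ?_ ?_
  · apply IsBoundedUnder.isCoboundedUnder_le
    refine ⟨-b, ?_⟩
    rw [eventually_map]
    filter_upwards [hpos] with ε hε
    rw [hset ε hε]
    have h1 := (abs_le.1 (habs ε hε)).1
    have h2 : ε⁻¹ * (-(b * ε)) = -b := by field_simp
    refine le_of_eq_of_le h2.symm ?_
    exact mul_le_mul_of_nonneg_left h1 (by positivity)
  · filter_upwards [hfan, hpos, hm (δ / (1 + b)) (by positivity), hm (ν' / (C1 + 1)) (by positivity)]
      with ε h1 hε h2 h3
    have h2' : ε * (1 + b) < δ := (lt_div_iff₀ (by positivity)).1 h2.2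
    have h3' : C1 * ε ≤ ν' := by
      have := (lt_div_iff₀ (by positivity)).1 h3.2
      linarith
    rw [hset ε hε]
    set I := ∫ t in (0:ℝ)..(b * ε), cos (γp t) with hI
    set Δ := R φ - R ψ with hΔd
    have hρ : ∀ ρ ∈ Ioo 0 ε, Δ * I ≤ Δ * (ε * (d2 - (k - dn) + 2 * ν')) + (Δ * d2 + C + Δ * b) * ρ := by
      intro ρ hρ
      have a1 := h1 ρ hρ.1 hρ.2
      have a2 := mul_le_mul_of_nonneg_left (hedge ε ρ hρ.1 hρ.2 h2') hΔ.le
      have a3 : ∫ s in ρ..ε, b * cos (γp (b * s)) = ∫ t in (b * ρ)..(b * ε), cos (γp t) := by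
        rw [intervalIntegral.integral_const_mul]
        exact intervalIntegral.mul_integral_comp_mul_left (f := fun t => cos (γp t)) b
      have a4 : I = (∫ t in (0:ℝ)..(b * ρ), cos (γp t)) + ∫ t in (b * ρ)..(b * ε), cos (γp t) :=
        (intervalIntegral.integral_add_adjacent_intervals (hii _ _) (hii _ _)).symm
      have a5 := mul_le_mul_of_nonneg_left (abs_le.1 (habs ρ hρ.1)).2 hΔ.le
      have a6 : Δ * ν' / E * E = Δ * ν' := by field_simp
      rw [a6] at a1
      have a7 : Δ * (C1 * ε ^ 2) ≤ Δ * (ν' * ε) := by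
        have : C1 * ε ^ 2 = C1 * ε * ε := by ring
        rw [this]
        gcongr
      rw [a4]
      rw [a3, ← hd2] at a2
      clear_value Δ d2 k dn ν' E
      linarith
    have hlim : Δ * I ≤ Δ * (ε * (d2 - (k - dn) + 2 * ν')) := by
      have ht : Tendsto (fun ρ : ℝ => Δ * (ε * (d2 - (k - dn) + 2 * ν')) + (Δ * d2 + C + Δ * b) * ρ)
          (𝓝[>] 0) (𝓝 (Δ * (ε * (d2 - (k - dn) + 2 * ν')) + (Δ * d2 + C + Δ * b) * 0)) :=
        ((continuous_const.add (continuous_const.mul continuous_id)).tendsto 0).mono_left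
          nhdsWithin_le_nhds
      rw [mul_zero, add_zero] at ht
      refine ge_of_tendsto ht ?_
      filter_upwards [hm ε hε] with ρ h using hρ ρ h
    have hI' := le_of_mul_le_mul_left hlim hΔ
    have hfin : d2 - (k - dn) + 2 * ν' = sin β / sin lam - 1 + ν := by
      rw [← hΨx, hν']; ring
    rw [hfin] at hI'
    rw [inv_mul_le_iff₀ hε]
    exact hI'
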